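/- In the first order setting, let x ∈ D₂ be the exact solution of A₂x = f, A₁*x = g, πx = k, let x̃ ∈ H₂ be arbitrary, and set e := x − x̃ and e_{A₂*} := π_{R(A₂*)}e. Then ‖e_{A₂*}‖²_{H₂} = max over ψ ∈ D(A₂*) of ( 2⟨f, ψ⟩_{H₃} − ⟨2x̃ + A₂*ψ, A₂*ψ⟩_{H₂} ), and the maximum is attained at the unique ψ̂ ∈ D(A₂*) ∩ N(A₂*)^⊥ with A₂*ψ̂ = e_{A₂*}. -/

import Mathlib

open Submodule LinearPMap RealInnerProductSpace

noncomputable section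

/-- The range of a partially defined linear operator, as a submodule. -/
def pRan {E F : Type*} [AddCommGroup E] [Module ℝ E] [AddCommGroup F] [Module ℝ F]
    (A : E →ₗ.[ℝ] F) : Submodule ℝ F :=
  LinearMap.range A.toFun

/-- The kernel of a partially defined linear operator, as a submodule of the ambient space. -/
def pKer {E F : Type*} [AddCommGroup E] [Module ℝ E] [AddCommGroup F] [Module ℝ F]
    (A : E →ₗ.[ℝ] F) : Submodule ℝ E :=
  (LinearMap.ker A.toFun).map A.domain.subtype

variable {H₁ H₂ H₃ : Type*}
  [NormedAddCommGroup H₁] [InnerProductSpace ℝ H₁] [CompleteSpace H₁]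
  [NormedAddCommGroup H₂] [InnerProductSpace ℝ H₂] [CompleteSpace H₂]
  [NormedAddCommGroup H₃] [InnerProductSpace ℝ H₃] [CompleteSpace H₃]

theorem mem_pKer_iff {E F : Type*} [AddCommGroup E] [Module ℝ E] [AddCommGroup F] [Module ℝ F]
    {A : E →ₗ.[ℝ] F} {y : E} : y ∈ pKer A ↔ ∃ h : y ∈ A.domain, A ⟨y, h⟩ = 0 := by
  constructor
  · rintro ⟨z, hz, rfl⟩
    exact ⟨z.2, hz⟩
  · rintro ⟨h, hy⟩
    exact ⟨⟨y, h⟩, hy, rfl⟩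

/-- The kernel of the adjoint is the orthogonal complement of the range. -/
theorem pKer_adjoint {E F : Type*} [NormedAddCommGroup E] [InnerProductSpace ℝ E] [CompleteSpace E]
    [NormedAddCommGroup F] [InnerProductSpace ℝ F]
    {A : E →ₗ.[ℝ] F} (hA : Dense (A.domain : Set E)) : pKer (A†) = (pRan A)ᗮ := by
  ext y
  rw [mem_pKer_iff, Submodule.mem_orthogonal']
  constructor
  · rintro ⟨h, hy⟩ _ ⟨z, rfl⟩
    have := adjoint_isFormalAdjoint hA ⟨y, h⟩ z
    rw [hy, inner_zero_left] at this
    exact this.symm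
  · intro hy
    have h0 : ∀ z : A.domain, ⟪(0 : E), (z : E)⟫ = ⟪y, A z⟫ := fun z => by
      rw [inner_zero_left]
      exact (hy _ ⟨z, rfl⟩).symm
    have h : y ∈ (A†).domain := mem_adjoint_domain_of_exists y ⟨0, h0⟩
    exact ⟨h, adjoint_apply_eq hA ⟨y, h⟩ h0⟩

/-- Every element of the range of the adjoint has a unique preimage orthogonal to its kernel. -/
theorem existsUnique_adjoint_eq {E F : Type*}
    [NormedAddCommGroup E] [InnerProductSpace ℝ E] [CompleteSpace E]
    [NormedAddCommGroup F] [InnerProductSpace ℝ F] [CompleteSpace F]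
    {A : E →ₗ.[ℝ] F} (hA : Dense (A.domain : Set E)) {v : E} (hv : v ∈ pRan (A†)) :
    ∃! ψ : (A†).domain, (ψ : F) ∈ (pKer (A†))ᗮ ∧ A† ψ = v := by
  obtain ⟨φ, rfl⟩ := hv
  have : (pKer (A†)).HasOrthogonalProjection := by
    rw [pKer_adjoint hA]
    infer_instance
  obtain ⟨p, hp, q, hq, hpq⟩ := (pKer (A†)).exists_add_mem_mem_orthogonal (φ : F)
  obtain ⟨hpd, hp0⟩ := mem_pKer_iff.1 hp
  have hqe : ((φ - ⟨p, hpd⟩ : (A†).domain) : F) = q := by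
    rw [AddSubgroupClass.coe_sub, hpq, add_sub_cancel_left]
  subst hqe
  refine ⟨φ - ⟨p, hpd⟩, ⟨hq, ?_⟩, ?_⟩
  · rw [LinearPMap.map_sub, hp0, sub_zero]
    rfl
  · rintro ψ ⟨hψ, hψv⟩
    have hker : ((ψ - (φ - ⟨p, hpd⟩) : (A†).domain) : F) ∈ pKer (A†) := by
      refine mem_pKer_iff.2 ⟨Subtype.property _, ?_⟩
      rw [Subtype.coe_eta, LinearPMap.map_sub, LinearPMap.map_sub, hp0, sub_zero, hψv]
      exact sub_self _
    have h0 : ((ψ - (φ - ⟨p, hpd⟩) : (A†).domain) : F) = 0 :=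
      inner_self_eq_zero.1 ((Submodule.mem_orthogonal _ _).1 (Submodule.sub_mem _ hψ hq) _ hker)
    exact sub_eq_zero.1 (Subtype.ext h0)

/-- Functional a posteriori error estimate, lower bound for the `R(A₂†)` part
of the error: with `e = x - xt` and `e_{A₂†} = π_{R(A₂†)} e`,
`‖e_{A₂†}‖² = max_{ψ ∈ D(A₂†)} ( 2⟪f, ψ⟫ - ⟪2xt + A₂†ψ, A₂†ψ⟫ )`, the maximum being attained at
the unique `ψ̂ ∈ D(A₂†) ∩ N(A₂†)^⊥` with `A₂† ψ̂ = e_{A₂†}`. -/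
theorem statement15 (A₁ : H₁ →ₗ.[ℝ] H₂) (A₂ : H₂ →ₗ.[ℝ] H₃)
    (hdense₁ : Dense (A₁.domain : Set H₁)) (hdense₂ : Dense (A₂.domain : Set H₂))
    (hclosed₁ : A₁.IsClosed) (hclosed₂ : A₂.IsClosed)
    (hcomplex : pRan A₁ ≤ pKer A₂)
    (hrange₁ : IsClosed (pRan A₁ : Set H₂)) (hrange₂ : IsClosed (pRan A₂ : Set H₃))
    (f : H₃) (g : H₁) (k : H₂)
    (hf : f ∈ pRan A₂) (hg : g ∈ pRan (A₁†)) (hk : k ∈ pKer A₂ ⊓ pKer (A₁†))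
    -- `x ∈ D₂` is the exact solution: `A₂ x = f`, `A₁† x = g`, `π x = k`
    (x : H₂) (hx₂ : x ∈ A₂.domain) (hx₁ : x ∈ (A₁†).domain)
    (hxf : A₂ ⟨x, hx₂⟩ = f) (hxg : A₁† ⟨x, hx₁⟩ = g)
    (hxk : x - k ∈ (pKer A₂ ⊓ pKer (A₁†))ᗮ)
    -- `xt` is an arbitrary (possibly nonconforming) approximation
    (xt : H₂)
    -- `eA₂s = π_{R(A₂†)} (x - xt)`
    (eA₂s : H₂) (heA₂s : eA₂s ∈ pRan (A₂†))
    (heA₂sperp : (x - xt) - eA₂s ∈ (pRan (A₂†))ᗮ) :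
    IsGreatest {r : ℝ | ∃ ψ : (A₂†).domain,
      r = 2 * ⟪f, (ψ : H₃)⟫ - ⟪(2 : ℝ) • xt + A₂† ψ, A₂† ψ⟫} (‖eA₂s‖ ^ 2)
    ∧ ∃ ψ : (A₂†).domain, (ψ : H₃) ∈ (pKer (A₂†))ᗮ ∧ A₂† ψ = eA₂s
        ∧ 2 * ⟪f, (ψ : H₃)⟫ - ⟪(2 : ℝ) • xt + A₂† ψ, A₂† ψ⟫ = ‖eA₂s‖ ^ 2
        ∧ (∀ ψ' : (A₂†).domain, (ψ' : H₃) ∈ (pKer (A₂†))ᗮ → A₂† ψ' = eA₂s → ψ' = ψ) := by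
  have key : ∀ ψ : (A₂†).domain,
      2 * ⟪f, (ψ : H₃)⟫ - ⟪(2 : ℝ) • xt + A₂† ψ, A₂† ψ⟫
        = ‖eA₂s‖ ^ 2 - ‖eA₂s - A₂† ψ‖ ^ 2 := by
    intro ψ
    have h1 : ⟪f, (ψ : H₃)⟫ = ⟪x, A₂† ψ⟫ := by
      rw [← hxf, real_inner_comm, ← adjoint_isFormalAdjoint hdense₂ ψ ⟨x, hx₂⟩, real_inner_comm]
    have h2 : ⟪x - xt - eA₂s, A₂† ψ⟫ = 0 :=
      (Submodule.mem_orthogonal' _ _).1 heA₂sperp _ ⟨ψ, rfl⟩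
    rw [inner_sub_left, inner_sub_left] at h2
    rw [h1, norm_sub_sq_real, inner_add_left, real_inner_smul_left, real_inner_self_eq_norm_sq]
    linarith
  obtain ⟨ψ, ⟨hψ, hψe⟩, huniq⟩ := existsUnique_adjoint_eq hdense₂ heA₂s
  have hval : 2 * ⟪f, (ψ : H₃)⟫ - ⟪(2 : ℝ) • xt + A₂† ψ, A₂† ψ⟫ = ‖eA₂s‖ ^ 2 := by
    rw [key, hψe]
    simp
  refine ⟨⟨⟨ψ, hval.symm⟩, ?_⟩, ψ, hψ, hψe, hval, fun ψ' h h' => huniq ψ' ⟨h, h'⟩⟩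
  rintro _ ⟨φ, rfl⟩
  rw [key]
  exact sub_le_self _ (sq_nonneg _)
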